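/- arXiv:2401.14265 — 2 statements merged into one kernel-verified Lean document; each statement's English description precedes it below -/
import Mathlib

section
/- Fix P > 0, n ≥ 1, and a vector a = (a_1,…,a_n) of nonnegative reals. Let X_1,…,X_n, Z_1,…,Z_n be independent real random variables with X_i Gaussian of mean 0 and variance a_i P and Z_i Gaussian of mean 0 and variance 1, and set Y_i = X_i + Z_i. Define γ := ∑_{i=1}^n log( φ_1(Y_i − X_i) / φ_{1+a_i P}(Y_i) ), where φ_v(x) = (2πv)^(−1/2) exp(−x²/(2v)) is the density of the centered Gaussian with variance v. Then for every t ∈ (0,1), the expectation E[exp(−t γ)] is finite and equals exp(−E(a,t)); equivalently, −log E[exp(−t γ)] = (1/2)·∑_{i=1}^n [ t·log(1 + a_i P) + log(1 − a_i P t²/(1 + a_i P)) ]. -/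
open Real Set Finset MeasureTheory ProbabilityTheory

/-- `E(a,t) = (1/2) ∑ᵢ [ t log(1 + aᵢP) + log(1 - aᵢP t²/(1 + aᵢP)) ]`. -/
noncomputable def E (P : ℝ) {n : ℕ} (a : Fin n → ℝ) (t : ℝ) : ℝ :=
  (1/2) * ∑ i, (t * Real.log (1 + a i * P) + Real.log (1 - a i * P * t ^ 2 / (1 + a i * P)))

/-- The density `φ_v(x) = (2πv)^(-1/2) exp(-x²/(2v))` of the centered Gaussian with
variance `v`. -/
noncomputable def gpdf (v x : ℝ) : ℝ :=
  (2 * Real.pi * v) ^ (-(1/2) : ℝ) * Real.exp (-x ^ 2 / (2 * v))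

/-- If the combined family `X i, Z j` is independent, then so is the family of pairs
`(X i, Z i)`. -/
lemma ProbabilityTheory.iIndepFun.prodMk_of_sumElim {Ω ι β : Type*} [MeasurableSpace Ω]
    {μ : Measure Ω} {mβ : MeasurableSpace β} {X Z : ι → Ω → β}
    (hX : ∀ i, Measurable (X i)) (hZ : ∀ i, Measurable (Z i))
    (h : iIndepFun (m := fun _ : ι ⊕ ι => mβ) (Sum.elim X Z) μ) :
    iIndepFun (fun i ω => (X i ω, Z i ω)) μ := by
  rw [iIndepFun_iff_iIndep]
  refine iIndepSets.iIndep (fun i => ((hX i).prodMk (hZ i)).comap_le)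
    (fun i => preimage (fun ω => (X i ω, Z i ω)) ''
      image2 (· ×ˢ ·) {s : Set β | MeasurableSet s} {s : Set β | MeasurableSet s})
    (fun i => ?_) (fun i => ?_) ?_
  · have := (isPiSystem_prod (α := β) (β := β)).comap (fun ω => (X i ω, Z i ω))
    convert! this using 1
  · rw [← MeasurableSpace.comap_generateFrom, generateFrom_prod]
  · rw [iIndepSets_iff]
    intro S f hf
    have hex : ∀ i, ∃ A B : Set β, MeasurableSet A ∧ MeasurableSet B ∧
        (i ∈ S → f i = X i ⁻¹' A ∩ Z i ⁻¹' B) := by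
      intro i
      by_cases hi : i ∈ S
      · obtain ⟨_, ⟨A, hA, B, hB, rfl⟩, hAB⟩ := hf i hi
        exact ⟨A, B, hA, hB, fun _ => hAB.symm⟩
      · exact ⟨∅, ∅, .empty, .empty, fun h => absurd h hi⟩
    choose A B hA hB hf' using hex
    have hmeas : ∀ j : ι ⊕ ι, MeasurableSet (Sum.elim A B j) := by
      rintro (j | j) <;> simp [hA, hB]
    have key := fun T : Finset (ι ⊕ ι) =>
      h.measure_inter_preimage_eq_mul T (sets := Sum.elim A B) (fun j _ => hmeas j)
    have h1 : (⋂ i ∈ S, f i) =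
        ⋂ j ∈ S.disjSum S, Sum.elim X Z j ⁻¹' Sum.elim A B j := by
      ext ω
      simp only [mem_iInter, Sum.forall, Finset.inl_mem_disjSum, Finset.inr_mem_disjSum,
        Sum.elim_inl, Sum.elim_inr]
      refine ⟨fun H => ⟨fun i hi => ?_, fun i hi => ?_⟩, fun H i hi => ?_⟩
      · have := H i hi
        rw [hf' i hi] at this
        exact this.1
      · have := H i hi
        rw [hf' i hi] at this
        exact this.2
      · rw [hf' i hi]
        exact ⟨H.1 i hi, H.2 i hi⟩
    have h2 : ∀ i ∈ S, μ (f i) = μ (X i ⁻¹' A i) * μ (Z i ⁻¹' B i) := by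
      intro i hi
      rw [hf' i hi]
      exact (h.indepFun (i := .inl i) (j := .inr i) (by simp)).measure_inter_preimage_eq_mul
        _ _ (hA i) (hB i)
    rw [h1, key, Finset.prod_disjSum, Finset.prod_congr rfl h2, Finset.prod_mul_distrib]
    rfl

/-- A centered Gaussian density times `exp (-b x² / 2 + c x)` is a multiple of a Gaussian
density. -/
lemma gaussianPDFReal_mul_exp_quadratic {v : NNReal} (hv : v ≠ 0) {b : ℝ} (hb : 0 < 1 + v * b)
    (c x : ℝ) :
    gaussianPDFReal 0 v x * exp (-b * x ^ 2 / 2 + c * x) =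
      ((√(1 + v * b))⁻¹ * exp (v * c ^ 2 / (2 * (1 + v * b)))) *
        gaussianPDFReal (v * c / (1 + v * b)) (v / (1 + v * b)).toNNReal x := by
  have hv' : (0 : ℝ) < v := by positivity
  rw [gaussianPDFReal, gaussianPDFReal, Real.coe_toNNReal _ (by positivity), mul_assoc,
    ← Real.exp_add, mul_mul_mul_comm, ← Real.exp_add, ← mul_inv, ← Real.sqrt_mul hb.le]
  congr 1
  · congr 2
    field_simp
  · congr 1
    field_simp
    ring

/-- The exponential of a quadratic is integrable against a centered Gaussian, provided the
quadratic coefficient does not exceed that of the density. -/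
lemma integrable_exp_quadratic_gaussianReal (v : NNReal) {b : ℝ} (hb : 0 < 1 + v * b) (c : ℝ) :
    Integrable (fun x => exp (-b * x ^ 2 / 2 + c * x)) (gaussianReal 0 v) := by
  by_cases hv : v = 0
  · subst hv
    rw [gaussianReal_zero_var]
    exact integrable_dirac (by simp)
  · rw [gaussianReal_of_var_ne_zero _ hv, integrable_withDensity_iff_integrable_smul'
      (measurable_gaussianPDF _ _) (ae_of_all _ fun _ => gaussianPDF_lt_top)]
    simp only [toReal_gaussianPDF, smul_eq_mul, gaussianPDFReal_mul_exp_quadratic hv hb]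
    exact (integrable_gaussianPDFReal _ _).const_mul _

/-- The integral of the exponential of a quadratic against a centered Gaussian. -/
lemma integral_exp_quadratic_gaussianReal (v : NNReal) {b : ℝ} (hb : 0 < 1 + v * b) (c : ℝ) :
    ∫ x, exp (-b * x ^ 2 / 2 + c * x) ∂gaussianReal 0 v =
      (√(1 + v * b))⁻¹ * exp (v * c ^ 2 / (2 * (1 + v * b))) := by
  by_cases hv : v = 0
  · subst hv
    simp [gaussianReal_zero_var]
  · have hv' : (0 : ℝ) < v := by positivity
    rw [integral_gaussianReal_eq_integral_smul hv]
    simp only [smul_eq_mul, gaussianPDFReal_mul_exp_quadratic hv hb]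
    rw [integral_const_mul, integral_gaussianPDFReal_eq_one _ (by
      simpa using div_pos hv' hb), mul_one]

/-- The information density of the scalar Gaussian channel with signal variance `s`. -/
lemma log_gpdf_div_gpdf {s : ℝ} (hs : 0 ≤ s) (x z : ℝ) :
    log (gpdf 1 (x + z - x) / gpdf (1 + s) (x + z)) =
      log (1 + s) / 2 - z ^ 2 / 2 + (x + z) ^ 2 / (2 * (1 + s)) := by
  have h1 : (0 : ℝ) < 1 + s := by positivity
  have h2 : 0 < 2 * π := by positivity
  have hlog : ∀ v > 0, ∀ y, 0 < gpdf v y ∧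
      log (gpdf v y) = -(1 / 2) * (log (2 * π) + log v) + -y ^ 2 / (2 * v) := by
    intro v hv y
    refine ⟨by unfold gpdf; positivity, ?_⟩
    rw [gpdf, Real.log_mul (by positivity) (by positivity), Real.log_exp,
      Real.log_rpow (by positivity), Real.log_mul h2.ne' hv.ne']
  rw [Real.log_div (hlog _ one_pos _).1.ne' (hlog _ h1 _).1.ne', (hlog _ one_pos _).2,
    (hlog _ h1 _).2, Real.log_one]
  ring

/-- Completing the square in the noise variable. -/
lemma exp_neg_mul_information_density {s : ℝ} (hs : 0 ≤ s) (t x z : ℝ) :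
    exp (-t * log (gpdf 1 (x + z - x) / gpdf (1 + s) (x + z))) =
      exp (-t * log (1 + s) / 2 - t * x ^ 2 / (2 * (1 + s))) *
        exp (-(t / (1 + s) - t) * z ^ 2 / 2 + -(t * x / (1 + s)) * z) := by
  have h1 : (0 : ℝ) < 1 + s := by positivity
  rw [log_gpdf_div_gpdf hs, ← Real.exp_add]
  congr 1
  field_simp
  ring

/-- Integrating out the noise variable. -/
lemma integral_exp_neg_mul_information_density {s t : ℝ} (hs : 0 ≤ s) (ht : t < 1) (x : ℝ) :
    ∫ z, exp (-t * log (gpdf 1 (x + z - x) / gpdf (1 + s) (x + z))) ∂gaussianReal 0 1 =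
      (exp (-t * log (1 + s) / 2) * (√((1 + s - t * s) / (1 + s)))⁻¹) *
        exp (-(t * (1 - t) / (1 + s - t * s)) * x ^ 2 / 2 + 0 * x) := by
  have h1 : (0 : ℝ) < 1 + s := by positivity
  have hpos : 0 < 1 + s - t * s := by nlinarith
  have hA : 1 + ((1 : NNReal) : ℝ) * (t / (1 + s) - t) = (1 + s - t * s) / (1 + s) := by
    push_cast
    field_simp
    ring
  simp only [exp_neg_mul_information_density hs]
  rw [integral_const_mul, integral_exp_quadratic_gaussianReal 1 (by rw [hA]; positivity), hA,
    mul_left_comm, ← Real.exp_add, mul_comm (exp (_ / 2)), mul_assoc, ← Real.exp_add]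
  congr 2
  push_cast
  field_simp
  ring

lemma measurable_gpdf (v : ℝ) : Measurable (gpdf v) := by
  unfold gpdf
  fun_prop

lemma measurable_information_density (s : ℝ) :
    Measurable fun p : ℝ × ℝ => log (gpdf 1 (p.1 + p.2 - p.1) / gpdf (1 + s) (p.1 + p.2)) := by
  have := measurable_gpdf
  fun_prop

/-- Exponential integrability of the scalar information density. -/
lemma integrable_prod_information_density {s t : ℝ} (hs : 0 ≤ s) (ht : t ∈ Ioo (0 : ℝ) 1) :
    Integrable (fun p : ℝ × ℝ =>
        exp (-t * log (gpdf 1 (p.1 + p.2 - p.1) / gpdf (1 + s) (p.1 + p.2))))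
      ((gaussianReal 0 s.toNNReal).prod (gaussianReal 0 1)) := by
  obtain ⟨ht0, ht1⟩ := ht
  have h1 : (0 : ℝ) < 1 + s := by positivity
  have hpos : 0 < 1 + s - t * s := by nlinarith
  have h1t : 0 < 1 - t := by linarith
  rw [integrable_prod_iff
    ((measurable_information_density s).const_mul (-t)).exp.aestronglyMeasurable]
  refine ⟨ae_of_all _ fun x => ?_, ?_⟩
  · simp only [exp_neg_mul_information_density hs]
    refine (integrable_exp_quadratic_gaussianReal 1 ?_ _).const_mul _
    have : 0 < t / (1 + s) := by positivity
    push_cast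
    linarith
  · simp only [Real.norm_eq_abs, Real.abs_exp, integral_exp_neg_mul_information_density hs ht1]
    exact (integrable_exp_quadratic_gaussianReal _ (by positivity) _).const_mul _

/-- The moment generating function of the scalar information density. -/
lemma integral_prod_information_density {s t : ℝ} (hs : 0 ≤ s) (ht : t ∈ Ioo (0 : ℝ) 1) :
    ∫ p : ℝ × ℝ, exp (-t * log (gpdf 1 (p.1 + p.2 - p.1) / gpdf (1 + s) (p.1 + p.2)))
      ∂((gaussianReal 0 s.toNNReal).prod (gaussianReal 0 1)) =
      exp (-(1 / 2 * (t * log (1 + s) + log (1 - s * t ^ 2 / (1 + s))))) := by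
  rw [integral_prod _ (integrable_prod_information_density hs ht)]
  obtain ⟨ht0, ht1⟩ := ht
  have h1 : (0 : ℝ) < 1 + s := by positivity
  have hpos : 0 < 1 + s - t * s := by nlinarith
  have h1t : 0 < 1 - t := by linarith
  have hC : 0 < 1 - s * t ^ 2 / (1 + s) := by
    rw [sub_pos, div_lt_one h1]
    nlinarith [mul_nonneg hs (by nlinarith : (0 : ℝ) ≤ 1 - t ^ 2)]
  simp only [integral_exp_neg_mul_information_density hs ht1]
  rw [integral_const_mul, integral_exp_quadratic_gaussianReal _ (by positivity),
    Real.coe_toNNReal _ hs]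
  have hprod : (1 + s - t * s) / (1 + s) * (1 + s * (t * (1 - t) / (1 + s - t * s))) =
      1 - s * t ^ 2 / (1 + s) := by
    rw [← mul_div_assoc, one_add_div hpos.ne', div_mul_div_comm, one_sub_div h1.ne',
      div_eq_div_iff (mul_pos h1 hpos).ne' h1.ne']
    ring
  have hsqrt : (√(1 - s * t ^ 2 / (1 + s)))⁻¹ = exp (-(log (1 - s * t ^ 2 / (1 + s)) / 2)) := by
    rw [Real.exp_neg, Real.exp_half, Real.exp_log hC]
  rw [mul_assoc, ← mul_assoc (√_)⁻¹, ← mul_inv, ← Real.sqrt_mul (by positivity), hprod, hsqrt]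
  simp only [ne_eq, OfNat.ofNat_ne_zero, not_false_eq_true, zero_pow, mul_zero, zero_div,
    Real.exp_zero, mul_one, ← Real.exp_add]
  congr 1
  ring

/-- **CGF evaluation (30), Appendix A.** For independent `Xᵢ ~ N(0, aᵢP)`, `Zᵢ ~ N(0,1)`,
`Yᵢ = Xᵢ + Zᵢ` and the information-density sum
`γ = ∑ᵢ log(φ₁(Yᵢ - Xᵢ)/φ_{1+aᵢP}(Yᵢ))`, one has `𝔼[exp(-tγ)] = exp(-E(a,t))` for all
`t ∈ (0,1)`. -/
theorem mgf_of_information_density_sum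
    {Ω : Type*} [MeasurableSpace Ω] (μ : Measure Ω) [IsProbabilityMeasure μ]
    (P : ℝ) (hP : 0 < P) (n : ℕ) (hn : 1 ≤ n) (a : Fin n → ℝ) (ha : ∀ i, 0 ≤ a i)
    (X Z : Fin n → Ω → ℝ)
    (hXm : ∀ i, Measurable (X i)) (hZm : ∀ i, Measurable (Z i))
    (hindep : iIndepFun (m := fun _ : Fin n ⊕ Fin n => (inferInstance : MeasurableSpace ℝ))
      (Sum.elim X Z) μ)
    (hX : ∀ i, μ.map (X i) = gaussianReal 0 (Real.toNNReal (a i * P)))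
    (hZ : ∀ i, μ.map (Z i) = gaussianReal 0 1)
    (t : ℝ) (ht : t ∈ Set.Ioo (0 : ℝ) 1) :
    Integrable (fun ω => Real.exp (-t *
        ∑ i, Real.log (gpdf 1 ((X i ω + Z i ω) - X i ω) /
          gpdf (1 + a i * P) (X i ω + Z i ω)))) μ
    ∧ ∫ ω, Real.exp (-t *
        ∑ i, Real.log (gpdf 1 ((X i ω + Z i ω) - X i ω) /
          gpdf (1 + a i * P) (X i ω + Z i ω))) ∂μ = Real.exp (-(E P a t)) := by
  set g : Fin n → ℝ × ℝ → ℝ := fun i p =>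
    Real.log (gpdf 1 (p.1 + p.2 - p.1) / gpdf (1 + a i * P) (p.1 + p.2))
  have hs : ∀ i, 0 ≤ a i * P := fun i => mul_nonneg (ha i) hP.le
  have hgm : ∀ i, Measurable (g i) := fun i => measurable_information_density _
  have hpair : ∀ i, Measurable fun ω => (X i ω, Z i ω) := fun i => (hXm i).prodMk (hZm i)
  have hlaw : ∀ i, μ.map (fun ω => (X i ω, Z i ω)) =
      (gaussianReal 0 (a i * P).toNNReal).prod (gaussianReal 0 1) := by
    intro i
    have hXZ : IndepFun (X i) (Z i) μ :=
      hindep.indepFun (i := .inl i) (j := .inr i) (by simp)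
    rw [(indepFun_iff_map_prod_eq_prod_map_map (hXm i).aemeasurable (hZm i).aemeasurable).1 hXZ,
      hX, hZ]
  have hind : iIndepFun (fun i ω => g i (X i ω, Z i ω)) μ :=
    (hindep.prodMk_of_sumElim hXm hZm).comp g hgm
  have hmeas : ∀ i, Measurable fun ω => g i (X i ω, Z i ω) := fun i => (hgm i).comp (hpair i)
  have hexp : ∀ i, Measurable fun p => Real.exp (-t * g i p) :=
    fun i => ((hgm i).const_mul _).exp
  have hint : ∀ i, Integrable (fun ω => Real.exp (-t * g i (X i ω, Z i ω))) μ := by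
    intro i
    have h := integrable_prod_information_density (hs i) ht
    rw [← hlaw i] at h
    exact h.comp_measurable (hpair i)
  have hmgf : ∀ i, mgf (fun ω => g i (X i ω, Z i ω)) μ (-t) = Real.exp
      (-(1 / 2 * (t * Real.log (1 + a i * P) +
        Real.log (1 - a i * P * t ^ 2 / (1 + a i * P))))) := by
    intro i
    rw [← integral_prod_information_density (hs i) ht, ← hlaw i,
      integral_map (hpair i).aemeasurable (hexp i).aestronglyMeasurable]
    rfl
  constructor
  · simpa only [Finset.sum_apply] using
      hind.integrable_exp_mul_sum hmeas (s := Finset.univ) (fun i _ => hint i)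
  · have h := hind.mgf_sum hmeas (t := -t) Finset.univ
    simp only [hmgf, ← Real.exp_sum, Finset.sum_neg_distrib, ← Finset.mul_sum] at h
    simpa only [mgf, E, Finset.sum_apply] using h
end

section
/- Fix P > 0, n ≥ 1, a vector a = (a_1,…,a_n) of nonnegative reals, and c ∈ ℝ. Let X_1,…,X_n, Z_1,…,Z_n, U be independent random variables with X_i Gaussian of mean 0 and variance a_i P, Z_i Gaussian of mean 0 and variance 1, and U uniformly distributed on (0,1); set Y_i = X_i + Z_i and γ := ∑_{i=1}^n log( φ_1(Y_i − X_i) / φ_{1+a_i P}(Y_i) ), where φ_v(x) = (2πv)^(−1/2) exp(−x²/(2v)). Define W := c − γ − log U. Then for every t ∈ (0,1), E[exp(t·W)] is finite and log E[exp(t·W)] = t·c − log(1 − t) − E(a,t). -/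
open Real Set Finset MeasureTheory ProbabilityTheory

/-- Functions measurable with respect to disjoint blocks of an independent family of σ-algebras:
the integral of the product is the product of the integrals. -/
theorem lintegral_prod_eq_prod_lintegral_of_iIndep_blocks {Ω ι κ : Type*} {mΩ : MeasurableSpace Ω}
    {μ : Measure Ω} {m : ι → MeasurableSpace Ω} (hle : ∀ i, m i ≤ mΩ)
    (hindep : iIndep m μ) {S : κ → Set ι} (hS : Pairwise (Function.onFun Disjoint S))
    {F : κ → Ω → ENNReal} (hF : ∀ k, Measurable[⨆ i ∈ S k, m i] (F k)) (s : Finset κ) :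
    ∫⁻ ω, ∏ k ∈ s, F k ω ∂μ = ∏ k ∈ s, ∫⁻ ω, F k ω ∂μ := by
  have : IsProbabilityMeasure μ := hindep.isProbabilityMeasure
  induction s using Finset.cons_induction with
  | empty => simp
  | cons j s hj ih =>
    simp only [Finset.prod_cons, ← ih]
    have hdisj : Disjoint (S j) (⋃ k ∈ s, S k) := by
      simp only [Set.disjoint_iUnion_right]
      exact fun k hk => hS fun h => hj (h ▸ hk)
    refine lintegral_mul_eq_lintegral_mul_lintegral_of_independent_measurableSpace
      (iSup₂_le fun i _ => hle i) (iSup₂_le fun i _ => hle i)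
      (indep_iSup_of_disjoint hle hindep hdisj) (hF j) ?_
    refine Finset.measurable_fun_prod s fun k hk => (hF k).mono ?_ le_rfl
    exact biSup_mono fun i hi => Set.mem_biUnion hk hi

/-- The integral of `exp (α x² + β x)` against a centered, possibly degenerate, Gaussian measure. -/
theorem lintegral_exp_quadratic_gaussianReal (v : NNReal) (α β : ℝ) (h : 0 < 1 - 2 * α * v) :
    ∫⁻ x, ENNReal.ofReal (Real.exp (α * x ^ 2 + β * x)) ∂gaussianReal 0 v =
      ENNReal.ofReal ((√(1 - 2 * α * v))⁻¹ *
        Real.exp (β ^ 2 * v / (2 * (1 - 2 * α * v)))) := by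
  rcases eq_or_ne v 0 with rfl | hv
  · simp
  have hv0 : (0 : ℝ) < v := by positivity
  obtain ⟨D, hD⟩ : ∃ D, D = 1 - 2 * α * v := ⟨_, rfl⟩
  rw [← hD] at h ⊢
  have hw : 0 < (v : ℝ) / D := by positivity
  have hα : α = (1 - D) / (2 * v) := by rw [hD]; field_simp; ring
  have key : ∀ x, ENNReal.ofReal (gaussianPDFReal 0 v x) *
      ENNReal.ofReal (Real.exp (α * x ^ 2 + β * x)) =
      ENNReal.ofReal ((√D)⁻¹ * Real.exp (β ^ 2 * v / (2 * D))) *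
        ENNReal.ofReal (gaussianPDFReal (β * (v / D)) (Real.toNNReal (v / D)) x) := by
    intro x
    rw [← ENNReal.ofReal_mul (gaussianPDFReal_nonneg _ _ _), ← ENNReal.ofReal_mul (by positivity)]
    congr 1
    simp only [gaussianPDFReal, Real.coe_toNNReal _ hw.le]
    have hs : √(2 * π * v) = √D * √(2 * π * (v / D)) := by
      rw [← Real.sqrt_mul h.le]; congr 1; field_simp
    rw [hs, mul_inv, mul_assoc, ← Real.exp_add, mul_mul_mul_comm, ← Real.exp_add]
    congr 2
    rw [hα]; field_simp; ring
  rw [gaussianReal_of_var_ne_zero _ hv, lintegral_withDensity_eq_lintegral_mul _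
    (measurable_gaussianPDF _ _) (by fun_prop)]
  simp only [Pi.mul_apply, gaussianPDF, key]
  rw [lintegral_const_mul _ (by fun_prop), lintegral_gaussianPDFReal_eq_one _ (by simpa using hw),
    mul_one]

/-- The tilted density ratio, written as an explicit Gaussian exponential in `x` and `z`. -/
theorem exp_neg_mul_log_gpdf_div {v : ℝ} (hv : 0 ≤ v) (t x z : ℝ) :
    Real.exp (-t * Real.log (gpdf 1 ((x + z) - x) / gpdf (1 + v) (x + z))) =
      Real.exp (-(t / 2) * Real.log (1 + v)) *
        (Real.exp (-t / (2 * (1 + v)) * x ^ 2) *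
        Real.exp ((t / 2 - t / (2 * (1 + v))) * z ^ 2 + (-t * x / (1 + v)) * z)) := by
  have hs : 0 < 1 + v := by linarith
  have hπ := Real.pi_pos
  rw [← Real.exp_add, ← Real.exp_add]
  congr 1
  unfold gpdf
  rw [Real.log_div (by positivity) (by positivity), Real.log_mul (by positivity) (by positivity),
    Real.log_mul (by positivity) (by positivity), Real.log_exp, Real.log_exp,
    Real.log_rpow (by positivity), Real.log_rpow (by positivity), mul_one,
    Real.log_mul (x := 2 * π) (y := 1 + v) (by positivity) (by positivity)]
  field_simp
  ring

/-- The expectation `𝔼[exp (-t γ)]` for a single coordinate. -/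
theorem lintegral_exp_neg_mul_log_gpdf_div {v : ℝ} (hv : 0 ≤ v) {t : ℝ}
    (ht : t ∈ Set.Ioo (0 : ℝ) 1) :
    ∫⁻ p, ENNReal.ofReal (Real.exp (-t * Real.log (gpdf 1 ((p.1 + p.2) - p.1) /
        gpdf (1 + v) (p.1 + p.2)))) ∂(gaussianReal 0 v.toNNReal).prod (gaussianReal 0 1) =
      ENNReal.ofReal (Real.exp (-((1 / 2) * (t * Real.log (1 + v) +
        Real.log (1 - v * t ^ 2 / (1 + v)))))) := by
  obtain ⟨ht0, ht1⟩ := ht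
  have hs : 0 < 1 + v := by linarith
  have hst : 0 < 1 + v - t * v := by nlinarith
  have hst2 : 0 < 1 + v - t ^ 2 * v := by nlinarith [mul_nonneg ht0.le hv, mul_pos ht0 hst]
  obtain ⟨D, hD⟩ : ∃ D, D = 1 - 2 * (t / 2 - t / (2 * (1 + v))) * ((1 : NNReal) : ℝ) := ⟨_, rfl⟩
  have hD' : D = (1 + v - t * v) / (1 + v) := by rw [hD]; simp; field_simp; ring
  have hD0 : 0 < D := by rw [hD']; positivity
  have hQ : 1 - v * t ^ 2 / (1 + v) = (1 + v - t ^ 2 * v) / (1 + v) := by field_simp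
  have hR : 1 - 2 * (-t / (2 * (1 + v)) + t ^ 2 / (2 * (1 + v) ^ 2 * D)) * (v.toNNReal : ℝ) =
      (1 - v * t ^ 2 / (1 + v)) / D := by
    rw [hQ, hD', Real.coe_toNNReal _ hv]; field_simp; ring
  have hQ0 : 0 < 1 - v * t ^ 2 / (1 + v) := by rw [hQ]; positivity
  simp only [exp_neg_mul_log_gpdf_div hv]
  rw [lintegral_prod _ (by fun_prop)]
  have hinner : ∀ x : ℝ, ∫⁻ z, ENNReal.ofReal (Real.exp (-(t / 2) * Real.log (1 + v)) *
        (Real.exp (-t / (2 * (1 + v)) * x ^ 2) *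
        Real.exp ((t / 2 - t / (2 * (1 + v))) * z ^ 2 + (-t * x / (1 + v)) * z)))
          ∂gaussianReal 0 1 =
      ENNReal.ofReal (Real.exp (-(t / 2) * Real.log (1 + v)) * (√D)⁻¹) *
        ENNReal.ofReal (Real.exp
          ((-t / (2 * (1 + v)) + t ^ 2 / (2 * (1 + v) ^ 2 * D)) * x ^ 2 + 0 * x)) := by
    intro x
    simp only [← mul_assoc]
    simp only [ENNReal.ofReal_mul (mul_pos (Real.exp_pos (-(t / 2) * Real.log (1 + v)))
      (Real.exp_pos (-t / (2 * (1 + v)) * x ^ 2))).le]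
    rw [lintegral_const_mul _ (by fun_prop),
      lintegral_exp_quadratic_gaussianReal _ _ _ (hD ▸ hD0), ← hD,
      ← ENNReal.ofReal_mul (by positivity), ← ENNReal.ofReal_mul (by positivity),
      mul_mul_mul_comm, ← Real.exp_add]
    congr 3
    simp only [NNReal.coe_one]
    field_simp
    ring
  simp only [hinner]
  rw [lintegral_const_mul _ (by fun_prop),
    lintegral_exp_quadratic_gaussianReal _ _ _ (by rw [hR]; positivity), hR,
    ← ENNReal.ofReal_mul (by positivity)]
  congr 1
  have hsq : (√D)⁻¹ * (√((1 - v * t ^ 2 / (1 + v)) / D))⁻¹ =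
      Real.exp (-(1 / 2 * Real.log (1 - v * t ^ 2 / (1 + v)))) := by
    rw [← mul_inv, ← Real.sqrt_mul hD0.le, mul_div_cancel₀ _ hD0.ne', Real.exp_neg,
      Real.sqrt_eq_rpow, Real.rpow_def_of_pos hQ0, mul_comm (Real.log _)]
  simp only [ne_eq, OfNat.ofNat_ne_zero, not_false_eq_true, zero_pow, zero_mul, zero_div,
    Real.exp_zero, mul_one]
  rw [mul_assoc, hsq, ← Real.exp_add]
  congr 1
  ring

/-- The expectation `𝔼[U ^ (-t)] = 1 / (1 - t)` for `U` uniform on `(0,1)`. -/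
theorem lintegral_exp_neg_mul_log_Ioo {t : ℝ} (ht : t < 1) :
    ∫⁻ u in Set.Ioo (0 : ℝ) 1, ENNReal.ofReal (Real.exp (-t * Real.log u)) =
      ENNReal.ofReal (Real.exp (-Real.log (1 - t))) := by
  have hrpow : ∀ u ∈ Set.Ioo (0 : ℝ) 1,
      ENNReal.ofReal (Real.exp (-t * Real.log u)) = ENNReal.ofReal (u ^ (-t)) := fun u hu => by
    rw [Real.rpow_def_of_pos hu.1, mul_comm]
  rw [setLIntegral_congr_fun measurableSet_Ioo hrpow, ← ofReal_integral_eq_lintegral_ofReal]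
  · rw [← integral_Ioc_eq_integral_Ioo, ← intervalIntegral.integral_of_le zero_le_one,
      integral_rpow (Or.inl (by linarith)), Real.exp_neg, Real.exp_log (by linarith)]
    rw [Real.one_rpow, Real.zero_rpow (by linarith), sub_zero, one_div]
    congr 2
    ring
  · rw [← IntegrableOn, ← integrableOn_Ioc_iff_integrableOn_Ioo, ← intervalIntegrable_iff_integrableOn_Ioc_of_le
      zero_le_one]
    exact intervalIntegral.intervalIntegrable_rpow' (by linarith)
  · filter_upwards [ae_restrict_mem measurableSet_Ioo] with u hu using Real.rpow_nonneg hu.1.le _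

/-- **CGF evaluation (28)–(30), Appendix A.** For independent `Xᵢ ~ N(0, aᵢP)`,
`Zᵢ ~ N(0,1)`, `U ~ Unif(0,1)`, `Yᵢ = Xᵢ + Zᵢ`,
`γ = ∑ᵢ log(φ₁(Yᵢ - Xᵢ)/φ_{1+aᵢP}(Yᵢ))` and `W = c - γ - log U`, one has, for every
`t ∈ (0,1)`, that `𝔼[exp(tW)]` is finite and
`log 𝔼[exp(tW)] = tc - log(1-t) - E(a,t)`. -/
theorem cgf_of_W
    {Ω : Type*} [MeasurableSpace Ω] (μ : Measure Ω) [IsProbabilityMeasure μ]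
    (P : ℝ) (hP : 0 < P) (n : ℕ) (hn : 1 ≤ n) (a : Fin n → ℝ) (ha : ∀ i, 0 ≤ a i)
    (c : ℝ) (X Z : Fin n → Ω → ℝ) (U : Ω → ℝ)
    (hXm : ∀ i, Measurable (X i)) (hZm : ∀ i, Measurable (Z i)) (hUm : Measurable U)
    (hindep : iIndepFun (m := fun _ : (Fin n ⊕ Fin n) ⊕ Unit => (inferInstance : MeasurableSpace ℝ))
      (Sum.elim (Sum.elim X Z) (fun _ => U)) μ)
    (hX : ∀ i, μ.map (X i) = gaussianReal 0 (Real.toNNReal (a i * P)))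
    (hZ : ∀ i, μ.map (Z i) = gaussianReal 0 1)
    (hU : μ.map U = volume.restrict (Set.Ioo (0 : ℝ) 1))
    (t : ℝ) (ht : t ∈ Set.Ioo (0 : ℝ) 1) :
    Integrable (fun ω => Real.exp (t * (c -
        (∑ i, Real.log (gpdf 1 ((X i ω + Z i ω) - X i ω) /
          gpdf (1 + a i * P) (X i ω + Z i ω))) - Real.log (U ω)))) μ
    ∧ Real.log (∫ ω, Real.exp (t * (c -
        (∑ i, Real.log (gpdf 1 ((X i ω + Z i ω) - X i ω) /
          gpdf (1 + a i * P) (X i ω + Z i ω))) - Real.log (U ω))) ∂μ) =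
      t * c - Real.log (1 - t) - E P a t := by
  let g : Fin n → ℝ × ℝ → ENNReal := fun i p => ENNReal.ofReal (Real.exp (-t * Real.log
    (gpdf 1 ((p.1 + p.2) - p.1) / gpdf (1 + a i * P) (p.1 + p.2))))
  let h : ℝ → ENNReal := fun u => ENNReal.ofReal (Real.exp (-t * Real.log u))
  let V : (Fin n ⊕ Fin n) ⊕ Unit → Ω → ℝ := Sum.elim (Sum.elim X Z) (fun _ => U)
  let m : (Fin n ⊕ Fin n) ⊕ Unit → MeasurableSpace Ω := fun k =>
    MeasurableSpace.comap (V k) inferInstance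
  let S : Option (Fin n) → Set ((Fin n ⊕ Fin n) ⊕ Unit) := fun k =>
    k.elim {Sum.inr ()} fun i => {Sum.inl (Sum.inl i), Sum.inl (Sum.inr i)}
  let F : Option (Fin n) → Ω → ENNReal := fun k =>
    k.elim (fun ω => h (U ω)) fun i ω => g i (X i ω, Z i ω)
  have hgm : ∀ i, Measurable (g i) := fun i => by unfold g gpdf; fun_prop
  have hhm : Measurable h := by fun_prop
  have hVm : ∀ k, Measurable (V k) := by rintro ((i | i) | u) <;> simp [V, hXm, hZm, hUm]
  have hV : ∀ (T : Set ((Fin n ⊕ Fin n) ⊕ Unit)), ∀ k ∈ T, Measurable[⨆ j ∈ T, m j] (V k) :=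
    fun T k hk => (comap_measurable (V k)).mono (le_biSup m hk) le_rfl
  have hS : Pairwise (Function.onFun Disjoint S) := by
    rintro (_ | i) (_ | j) hij <;> simp_all [S, Function.onFun, eq_comm]
  have hF : ∀ k, Measurable[⨆ i ∈ S k, m i] (F k) := by
    rintro (_ | i)
    · exact hhm.comp (hV _ (Sum.inr ()) rfl)
    · exact (hgm i).comp (Measurable.prodMk (hV _ (Sum.inl (Sum.inl i)) (Or.inl rfl))
        (hV _ (Sum.inl (Sum.inr i)) (Or.inr rfl)))
  have hprod := lintegral_prod_eq_prod_lintegral_of_iIndep_blocks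
    (fun k => (hVm k).comap_le) hindep hS hF Finset.univ
  have hFU : ∫⁻ ω, F none ω ∂μ = ENNReal.ofReal (Real.exp (-Real.log (1 - t))) := by
    rw [← lintegral_exp_neg_mul_log_Ioo ht.2, ← hU, lintegral_map hhm hUm]
    rfl
  have hFg : ∀ i, ∫⁻ ω, F (some i) ω ∂μ = ENNReal.ofReal (Real.exp (-((1 / 2) *
      (t * Real.log (1 + a i * P) + Real.log (1 - a i * P * t ^ 2 / (1 + a i * P)))))) := by
    intro i
    have hXZ : IndepFun (X i) (Z i) μ :=
      hindep.indepFun (i := Sum.inl (Sum.inl i)) (j := Sum.inl (Sum.inr i)) (by simp)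
    rw [← lintegral_exp_neg_mul_log_gpdf_div (mul_nonneg (ha i) hP.le) ht, ← hX i, ← hZ i,
      ← hXZ.map_prod_eq_prod_map_map (hXm i).aemeasurable (hZm i).aemeasurable,
      lintegral_map (hgm i) ((hXm i).prodMk (hZm i))]
    rfl
  have hW : ∀ ω, ENNReal.ofReal (Real.exp (t * (c -
        (∑ i, Real.log (gpdf 1 ((X i ω + Z i ω) - X i ω) /
          gpdf (1 + a i * P) (X i ω + Z i ω))) - Real.log (U ω)))) =
      ENNReal.ofReal (Real.exp (t * c)) * ∏ k, F k ω := by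
    intro ω
    simp only [Fintype.prod_option, F, g, h, Option.elim]
    rw [← ENNReal.ofReal_prod_of_nonneg fun _ _ => (Real.exp_pos _).le, ← Real.exp_sum,
      ← ENNReal.ofReal_mul (Real.exp_pos _).le, ← ENNReal.ofReal_mul (Real.exp_pos _).le,
      ← Real.exp_add, ← Real.exp_add, ← Finset.mul_sum]
    congr 2
    ring
  have hFm : ∀ k, Measurable (F k) := fun k => (hF k).mono (iSup₂_le fun i _ => (hVm i).comap_le)
    le_rfl
  have hL : ∫⁻ ω, ENNReal.ofReal (Real.exp (t * (c -
        (∑ i, Real.log (gpdf 1 ((X i ω + Z i ω) - X i ω) /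
          gpdf (1 + a i * P) (X i ω + Z i ω))) - Real.log (U ω)))) ∂μ =
      ENNReal.ofReal (Real.exp (t * c - Real.log (1 - t) - E P a t)) := by
    simp only [hW]
    rw [lintegral_const_mul _ (Finset.measurable_fun_prod _ fun k _ => hFm k), hprod,
      Fintype.prod_option, hFU]
    simp only [hFg]
    rw [← ENNReal.ofReal_prod_of_nonneg fun _ _ => (Real.exp_pos _).le, ← Real.exp_sum,
      ← ENNReal.ofReal_mul (Real.exp_pos _).le, ← ENNReal.ofReal_mul (Real.exp_pos _).le,
      ← Real.exp_add, ← Real.exp_add, Finset.sum_neg_distrib, ← Finset.mul_sum, E]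
    congr 2
    ring
  have hmeas : Measurable fun ω => Real.exp (t * (c -
        (∑ i, Real.log (gpdf 1 ((X i ω + Z i ω) - X i ω) /
          gpdf (1 + a i * P) (X i ω + Z i ω))) - Real.log (U ω))) := by
    unfold gpdf
    fun_prop
  refine ⟨⟨hmeas.aestronglyMeasurable, ?_⟩, ?_⟩
  · rw [hasFiniteIntegral_iff_ofReal (ae_of_all _ fun ω => (Real.exp_pos _).le), hL]
    exact ENNReal.ofReal_lt_top
  · rw [integral_eq_lintegral_of_nonneg_ae (ae_of_all _ fun ω => (Real.exp_pos _).le)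
      hmeas.aestronglyMeasurable, hL, ENNReal.toReal_ofReal (Real.exp_pos _).le, Real.log_exp]
end
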